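/- Let a₁, …, aₙ be real numbers such that |aᵢ − aⱼ| > 1 for all i ≠ j. Then every root μ ∈ ℂ of the characteristic polynomial of the 2ⁿ×2ⁿ matrix R(a₁,…,aₙ) is a positive real number (i.e., μ has zero imaginary part and positive real part). -/

import Mathlib

/-- The operator on `(ℂ²)^{⊗ n}` exchanging the `k`-th and `l`-th tensor factors,
as a permutation matrix on the standard basis indexed by `Fin n → Fin 2`. -/
def Pmat (n : ℕ) (k l : Fin n) : Matrix (Fin n → Fin 2) (Fin n → Fin 2) ℂ :=
  Matrix.of fun f g => if g = f ∘ (Equiv.swap k l) then 1 else 0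

/-- The rational R-matrix `R_{kl}(u) = 1 - u⁻¹ • P_{kl}`. -/
noncomputable def Rmat (n : ℕ) (k l : Fin n) (u : ℂ) :
    Matrix (Fin n → Fin 2) (Fin n → Fin 2) ℂ :=
  1 - u⁻¹ • Pmat n k l

/-- The ordered product `R(a₁,…,aₙ) = ∏_{l=n-1,…,1} ∏_{k=n-l,…,1} R_{l,l+k}(a_l - a_{l+k})`,
with larger `l` placed further left and, within a fixed `l`, larger `k` placed further left;
the rightmost factor is `R_{1,2}(a₁ - a₂)` and the leftmost is `R_{n-1,n}(a_{n-1} - aₙ)`.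
(Tensor positions `1,…,n` are `0,…,n-1 : Fin n`.) -/
noncomputable def RmatProd (n : ℕ) (a : Fin n → ℂ) :
    Matrix (Fin n → Fin 2) (Fin n → Fin 2) ℂ :=
  (((List.range (n - 1)).reverse).flatMap fun l =>
    ((List.range (n - 1 - l)).reverse).map fun k =>
      if h : l + k + 1 < n then
        Rmat n ⟨l, by omega⟩ ⟨l + k + 1, h⟩ (a ⟨l, by omega⟩ - a ⟨l + k + 1, h⟩)
      else 1).prod

/-! ### Ordered products of elements satisfying the Yang–Baxter equation -/

section OrderedProduct

variable {ι M : Type*} [Monoid M]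

/-- The product of `R x y` over `y ∈ l`, with later entries of `l` placed further left. -/
def rowProd (R : ι → ι → M) (x : ι) : List ι → M
  | [] => 1
  | y :: l => rowProd R x l * R x y

/-- The product of `R x y` over all pairs with `x` before `y` in `l`, later `x` further left and,
for fixed `x`, later `y` further left. -/
def pairProd (R : ι → ι → M) : List ι → M
  | [] => 1
  | x :: l => pairProd R l * rowProd R x l

/-- `R` satisfies the Yang–Baxter equation on distinct indices, and elements with disjoint
indices commute. -/
structure IsYangBaxter (R : ι → ι → M) : Prop where
  braid : ∀ x y z, x ≠ y → x ≠ z → y ≠ z → R y z * R x z * R x y = R x y * R x z * R y z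
  comm : ∀ x y z w, x ≠ z → x ≠ w → y ≠ z → y ≠ w → x ≠ y → z ≠ w →
    Commute (R x y) (R z w)

variable {R : ι → ι → M}

theorem IsYangBaxter.commute_rowProd (hR : IsYangBaxter R) {x y z : ι} {l : List ι}
    (hxz : x ≠ z) (hyz : y ≠ z) (hxy : x ≠ y) (hx : x ∉ l) (hy : y ∉ l) (hz : z ∉ l) :
    Commute (R x y) (rowProd R z l) := by
  induction l with
  | nil => exact Commute.one_right _
  | cons w l ih =>
    simp only [List.mem_cons, not_or] at hx hy hz
    exact (ih hx.2 hy.2 hz.2).mul_right (hR.comm x y z w hxz hx.1 hyz hy.1 hxy hz.1)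

theorem IsYangBaxter.commute_pairProd (hR : IsYangBaxter R) {x y : ι} {l : List ι}
    (hxy : x ≠ y) (hx : x ∉ l) (hy : y ∉ l) (hl : l.Nodup) :
    Commute (R x y) (pairProd R l) := by
  induction l with
  | nil => exact Commute.one_right _
  | cons z l ih =>
    simp only [List.mem_cons, not_or] at hx hy
    rw [List.nodup_cons] at hl
    exact (ih hx.2 hy.2 hl.2).mul_right
      (hR.commute_rowProd hx.1 hy.1 hxy hx.2 hy.2 hl.1)

theorem IsYangBaxter.rowProd_mul_rowProd (hR : IsYangBaxter R) {x y : ι} {l : List ι}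
    (hxy : x ≠ y) (hx : x ∉ l) (hy : y ∉ l) (hl : l.Nodup) :
    rowProd R y l * rowProd R x l * R x y = R x y * rowProd R x l * rowProd R y l := by
  induction l with
  | nil => simp [rowProd]
  | cons z l ih =>
    simp only [List.mem_cons, not_or] at hx hy
    rw [List.nodup_cons] at hl
    have hyz : R y z * rowProd R x l = rowProd R x l * R y z :=
      hR.commute_rowProd (Ne.symm hxy) (Ne.symm hx.1) hy.1 hy.2 hl.1 hx.2
    have hxz : R x z * rowProd R y l = rowProd R y l * R x z :=
      hR.commute_rowProd hxy (Ne.symm hy.1) hx.1 hx.2 hl.1 hy.2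
    calc rowProd R y l * R y z * (rowProd R x l * R x z) * R x y
        = rowProd R y l * (R y z * rowProd R x l) * R x z * R x y := by simp only [mul_assoc]
      _ = rowProd R y l * rowProd R x l * (R y z * R x z * R x y) := by
        rw [hyz]; simp only [mul_assoc]
      _ = (rowProd R y l * rowProd R x l * R x y) * R x z * R y z := by
        rw [hR.braid x y z hxy hx.1 hy.1]; simp only [mul_assoc]
      _ = R x y * rowProd R x l * (rowProd R y l * R x z) * R y z := by
        rw [ih hx.2 hy.2 hl.2]; simp only [mul_assoc]
      _ = R x y * (rowProd R x l * R x z) * (rowProd R y l * R y z) := by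
        rw [← hxz]; simp only [mul_assoc]

theorem star_rowProd_mul_pairProd [StarMul M] (hR : IsYangBaxter R)
    (hstar : ∀ x y, star (R x y) = R x y) {x : ι} {l : List ι} (hx : x ∉ l) (hl : l.Nodup) :
    star (rowProd R x l) * pairProd R l = pairProd R l * rowProd R x l := by
  induction l with
  | nil => simp [rowProd, pairProd]
  | cons y l ih =>
    simp only [List.mem_cons, not_or] at hx
    rw [List.nodup_cons] at hl
    calc star (rowProd R x l * R x y) * (pairProd R l * rowProd R y l)
        = R x y * (star (rowProd R x l) * pairProd R l) * rowProd R y l := by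
          rw [star_mul, hstar]; simp only [mul_assoc]
      _ = R x y * pairProd R l * rowProd R x l * rowProd R y l := by
        rw [ih hx.2 hl.2]; simp only [mul_assoc]
      _ = pairProd R l * (R x y * rowProd R x l * rowProd R y l) := by
        rw [(hR.commute_pairProd hx.1 hx.2 hl.1 hl.2).eq]; simp only [mul_assoc]
      _ = pairProd R l * rowProd R y l * (rowProd R x l * R x y) := by
        rw [← hR.rowProd_mul_rowProd hx.1 hx.2 hl.1 hl.2]; simp only [mul_assoc]

theorem isSelfAdjoint_pairProd [StarMul M] (hR : IsYangBaxter R)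
    (hstar : ∀ x y, star (R x y) = R x y) {l : List ι} (hl : l.Nodup) :
    IsSelfAdjoint (pairProd R l) := by
  induction l with
  | nil => exact IsSelfAdjoint.one M
  | cons x l ih =>
    rw [List.nodup_cons] at hl
    rw [isSelfAdjoint_iff, pairProd, star_mul, (ih hl.2).star_eq,
      star_rowProd_mul_pairProd hR hstar hl.1 hl.2]

theorem isUnit_pairProd (hR : ∀ x y, x ≠ y → IsUnit (R x y)) {l : List ι} (hl : l.Nodup) :
    IsUnit (pairProd R l) := by
  have hrow : ∀ x, ∀ l : List ι, x ∉ l → IsUnit (rowProd R x l) := by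
    intro x l hx
    induction l with
    | nil => exact isUnit_one
    | cons y l ih =>
      simp only [List.mem_cons, not_or] at hx
      exact (ih hx.2).mul (hR x y hx.1)
  induction l with
  | nil => exact isUnit_one
  | cons x l ih =>
    rw [List.nodup_cons] at hl
    exact (ih hl.2).mul (hrow x l hl.1)

theorem continuous_pairProd {X : Type*} [TopologicalSpace X] [TopologicalSpace M]
    [ContinuousMul M] {R : X → ι → ι → M} (hR : ∀ x y, Continuous fun t => R t x y)
    (l : List ι) : Continuous fun t => pairProd (R t) l := by
  have hrow : ∀ x, ∀ l : List ι, Continuous fun t => rowProd (R t) x l := by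
    intro x l
    induction l with
    | nil => exact continuous_const
    | cons y l ih => exact ih.mul (hR x y)
  induction l with
  | nil => exact continuous_const
  | cons x l ih => exact ih.mul (hrow x l)

theorem pairProd_range' (R : ℕ → ℕ → M) (s m : ℕ) :
    pairProd R (List.range' s m) = ((List.range (m - 1)).reverse.flatMap fun l =>
      (List.range (m - 1 - l)).reverse.map fun k => R (s + l) (s + l + k + 1)).prod := by
  have hrow : ∀ x s m, rowProd R x (List.range' s m) =
      ((List.range m).reverse.map fun k => R x (s + k)).prod := by
    intro x s m
    induction m generalizing s with
    | zero => simp [rowProd]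
    | succ m ih =>
      rw [List.range'_succ, rowProd, ih, List.range_succ_eq_map]
      simp [Function.comp_def, add_assoc, add_comm 1]
  induction m generalizing s with
  | zero => simp [pairProd]
  | succ m ih =>
    rw [List.range'_succ, pairProd, ih, hrow]
    cases m with
    | zero => simp
    | succ m =>
      simp only [Nat.add_sub_cancel]
      rw [show (List.range (m + 1)).reverse.flatMap (fun l =>
          (List.range (m + 1 - l)).reverse.map fun k => R (s + l) (s + l + k + 1)) =
            ((List.range m).map Nat.succ).reverse.flatMap (fun l =>
              (List.range (m + 1 - l)).reverse.map fun k => R (s + l) (s + l + k + 1)) ++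
            (List.range (m + 1)).reverse.map fun k => R s (s + k + 1) by
          conv_lhs => rw [List.range_succ_eq_map, List.reverse_cons, List.flatMap_append]
          simp,
        List.prod_append, ← List.map_reverse, List.flatMap_map]
      simp [add_assoc, add_comm 1, -List.map_reverse]

end OrderedProduct

/-! ### Positive definiteness along connected families -/

section Path

open scoped ComplexOrder Matrix

variable {X m : Type*} [TopologicalSpace X] [Fintype m]

theorem isOpen_setOf_posDef {A : X → Matrix m m ℂ} (hA : Continuous A)
    (hherm : ∀ x, (A x).IsHermitian) : IsOpen {x | (A x).PosDef} := by
  have hcont : Continuous fun p : X × (m → ℂ) => (star p.2 ⬝ᵥ (A p.1 *ᵥ p.2)).re :=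
    Complex.continuous_re.comp <| continuous_snd.star.dotProduct <|
      (hA.comp continuous_fst).matrix_mulVec continuous_snd
  have hiff : ∀ x, (A x).PosDef ↔
      ∀ v ∈ Metric.sphere (0 : m → ℂ) 1, 0 < (star v ⬝ᵥ (A x *ᵥ v)).re := by
    intro x
    refine ⟨fun h v hv => ?_, fun h => .of_dotProduct_mulVec_pos (hherm x) fun v hv => ?_⟩
    · have hv0 : v ≠ 0 := ne_zero_of_mem_unit_sphere (⟨v, hv⟩ : Metric.sphere (0 : m → ℂ) 1)
      exact (Complex.pos_iff.1 (h.dotProduct_mulVec_pos hv0)).1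
    · rw [Complex.pos_iff]
      refine ⟨?_, ((hherm x).im_star_dotProduct_mulVec_self v).symm⟩
      have hn : 0 < ‖v‖ := norm_pos_iff.2 hv
      have := h ((‖v‖⁻¹ : ℝ) • v) (by simp [norm_smul, hn.ne'])
      rw [star_smul, Matrix.mulVec_smul, smul_dotProduct, dotProduct_smul] at this
      simpa [hn] using this
  rw [isOpen_iff_eventually]
  intro x hx
  simp only [Set.mem_ofPred_eq, hiff] at hx ⊢
  exact (isCompact_sphere _ _).eventually_forall_of_forall_eventually fun v hv =>
    hcont.continuousAt.eventually_const_lt (hx v hv)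

theorem isClosed_setOf_posSemidef {A : X → Matrix m m ℂ} (hA : Continuous A) :
    IsClosed {x | (A x).PosSemidef} := by
  simp only [Matrix.posSemidef_iff_dotProduct_mulVec, Set.ofPred_and, Set.ofPred_forall]
  refine (isClosed_eq hA.matrix_conjTranspose hA).inter <| isClosed_iInter fun v => ?_
  exact isClosed_le continuous_const
    (continuous_const.dotProduct (hA.matrix_mulVec continuous_const))

theorem posDef_of_preconnectedSpace [DecidableEq m] [PreconnectedSpace X] {A : X → Matrix m m ℂ}
    (hA : Continuous A) (hherm : ∀ x, (A x).IsHermitian) (hunit : ∀ x, IsUnit (A x))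
    {x₀ : X} (h₀ : (A x₀).PosDef) (x : X) : (A x).PosDef := by
  have hset : {x | (A x).PosDef} = {x | (A x).PosSemidef} :=
    Set.ext fun x => ⟨fun h => h.posSemidef, fun h => h.posDef_iff_isUnit.2 (hunit x)⟩
  have hclopen : IsClopen {x | (A x).PosDef} :=
    ⟨hset ▸ isClosed_setOf_posSemidef hA, isOpen_setOf_posDef hA hherm⟩
  exact Set.eq_univ_iff_forall.1 (hclopen.eq_univ ⟨x₀, h₀⟩) x

end Path

/-! ### The rational R-matrix -/

section RMatrix

open scoped ComplexOrder Matrix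

variable {n : ℕ}

/-- The action of permutations of the tensor factors on `(ℂ²)^{⊗ n}`. -/
def tensorPerm (n : ℕ) :
    Equiv.Perm (Fin n) →* Matrix (Fin n → Fin 2) (Fin n → Fin 2) ℂ where
  toFun σ := Matrix.of fun f g => if g = f ∘ σ then 1 else 0
  map_one' := by
    ext f g
    simp [Matrix.one_apply, eq_comm]
  map_mul' σ τ := by
    ext f g
    simp only [Matrix.mul_apply, Matrix.of_apply, ← ite_and, mul_boole]
    rw [Finset.sum_eq_single (f ∘ σ)] <;> simp +contextual [Function.comp_assoc]
    rfl

theorem Pmat_eq (k l : Fin n) : Pmat n k l = tensorPerm n (Equiv.swap k l) := rfl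

theorem swap_mul_swap_eq {α : Type*} [DecidableEq α] {x y z : α} (hxy : x ≠ y) (hxz : x ≠ z)
    (hyz : y ≠ z) : Equiv.swap x y * Equiv.swap x z = Equiv.swap x z * Equiv.swap y z := by
  ext w
  simp only [Equiv.Perm.mul_apply, Equiv.swap_apply_def]
  grind

theorem Pmat_comm (k l : Fin n) : Pmat n k l = Pmat n l k := by
  rw [Pmat_eq, Pmat_eq, Equiv.swap_comm]

theorem Pmat_mul_self (k l : Fin n) : Pmat n k l * Pmat n k l = 1 := by
  rw [Pmat_eq, ← map_mul, Equiv.swap_mul_self, map_one]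

theorem Pmat_mul_Pmat {x y z : Fin n} (hxy : x ≠ y) (hxz : x ≠ z) (hyz : y ≠ z) :
    Pmat n x y * Pmat n x z = Pmat n x z * Pmat n y z := by
  simp only [Pmat_eq, ← map_mul, swap_mul_swap_eq hxy hxz hyz]

theorem conjTranspose_Pmat (k l : Fin n) : (Pmat n k l)ᴴ = Pmat n k l := by
  ext f g
  have h : f = g ∘ Equiv.swap k l ↔ g = f ∘ Equiv.swap k l := by
    constructor <;> (rintro rfl; ext i; simp)
  simp [Pmat, Matrix.conjTranspose_apply, h, apply_ite]

theorem Rmat_yangBaxter {x y z : Fin n} (hxy : x ≠ y) (hxz : x ≠ z) (hyz : y ≠ z)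
    {u v w : ℂ} (h : u⁻¹ * v⁻¹ + v⁻¹ * w⁻¹ = u⁻¹ * w⁻¹) :
    Rmat n y z w * Rmat n x z v * Rmat n x y u =
      Rmat n x y u * Rmat n x z v * Rmat n y z w := by
  have e₁ := Pmat_mul_Pmat hxy hxz hyz
  have e₂ := Pmat_mul_Pmat hxz hxy hyz.symm
  have e₃ := Pmat_mul_Pmat hxy.symm hyz hxz
  have e₄ := Pmat_mul_Pmat hyz hxy.symm hxz.symm
  rw [Pmat_comm z y] at e₂
  rw [Pmat_comm y x] at e₃ e₄
  rw [Pmat_comm z x] at e₄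
  have e₆ : Pmat n x y * Pmat n x z * Pmat n y z = Pmat n x z := by
    rw [e₁, mul_assoc, Pmat_mul_self, mul_one]
  have e₅ : Pmat n y z * Pmat n x z * Pmat n x y = Pmat n x z := by
    rw [mul_assoc, e₂, ← mul_assoc, e₄, e₆]
  simp only [Rmat, mul_sub, sub_mul, one_mul, mul_one, smul_mul_assoc, mul_smul_comm, e₅, e₆]
  simp only [← e₃, e₂, e₄, ← e₁]
  generalize Pmat n x y * Pmat n y z = X
  generalize Pmat n x y * Pmat n x z = Y
  match_scalars <;>
    first | ring1 | linear_combination h | linear_combination -h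

theorem commute_Rmat {x y z w : Fin n} (hxz : x ≠ z) (hxw : x ≠ w) (hyz : y ≠ z) (hyw : y ≠ w)
    (u v : ℂ) : Commute (Rmat n x y u) (Rmat n z w v) := by
  have hP : Commute (Pmat n x y) (Pmat n z w) := by
    simp only [Pmat_eq]
    refine Commute.map (Equiv.Perm.Disjoint.commute fun i => ?_) (tensorPerm n)
    by_cases h : i = x ∨ i = y
    · right
      apply Equiv.swap_apply_of_ne_of_ne <;> grind
    · left
      rw [not_or] at h
      exact Equiv.swap_apply_of_ne_of_ne h.1 h.2
  exact ((Commute.one_left _).sub_left ((Commute.one_right _).sub_right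
    (hP.smul_right v⁻¹) |>.smul_left u⁻¹))

theorem conjTranspose_Rmat (k l : Fin n) {u : ℂ} (hu : star u = u) :
    (Rmat n k l u)ᴴ = Rmat n k l u := by
  simp [Rmat, Matrix.conjTranspose_sub, Matrix.conjTranspose_smul, conjTranspose_Pmat, hu]

theorem isUnit_Rmat {k l : Fin n} {u : ℂ} (hu : u⁻¹ ^ 2 ≠ 1) : IsUnit (Rmat n k l u) := by
  have h : Rmat n k l u * (1 + u⁻¹ • Pmat n k l) = (1 - u⁻¹ ^ 2) • 1 := by
    simp only [Rmat, mul_add, sub_mul, one_mul, mul_one, smul_mul_assoc, mul_smul_comm,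
      Pmat_mul_self]
    module
  rw [Matrix.isUnit_iff_isUnit_det, isUnit_iff_ne_zero]
  intro h0
  have := congrArg Matrix.det h
  rw [Matrix.det_mul, h0, zero_mul, Matrix.det_smul, Matrix.det_one, mul_one] at this
  exact pow_ne_zero _ (sub_ne_zero.2 hu.symm) this.symm

/-- The matrix `R_{ij}(a_i - a_j)`, extended by the identity to indices outside the range. -/
noncomputable def natRmat (n : ℕ) (a : Fin n → ℂ) (i j : ℕ) :
    Matrix (Fin n → Fin 2) (Fin n → Fin 2) ℂ :=
  if h : i < n ∧ j < n then Rmat n ⟨i, h.1⟩ ⟨j, h.2⟩ (a ⟨i, h.1⟩ - a ⟨j, h.2⟩) else 1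

theorem RmatProd_eq_pairProd (a : Fin n → ℂ) :
    RmatProd n a = pairProd (natRmat n a) (List.range n) := by
  rw [List.range_eq_range', pairProd_range', RmatProd]
  congr! 6 with l k
  simp only [natRmat, zero_add]
  split_ifs <;> first | rfl | omega

theorem isYangBaxter_natRmat {a : Fin n → ℂ} (ha : Function.Injective a) (s : ℂ) :
    IsYangBaxter (natRmat n fun i => a i / s) where
  braid x y z hxy hxz hyz := by
    by_cases hx : x < n <;> by_cases hy : y < n <;> by_cases hz : z < n <;>
      simp only [natRmat, hx, hy, hz, and_self, and_true, and_false, dite_true, dite_false,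
        mul_one, one_mul]
    refine Rmat_yangBaxter (by simpa using hxy) (by simpa using hxz) (by simpa using hyz) ?_
    have h₁ : a ⟨x, hx⟩ - a ⟨y, hy⟩ ≠ 0 := sub_ne_zero.2 (ha.ne (by simpa using hxy))
    have h₂ : a ⟨x, hx⟩ - a ⟨z, hz⟩ ≠ 0 := sub_ne_zero.2 (ha.ne (by simpa using hxz))
    have h₃ : a ⟨y, hy⟩ - a ⟨z, hz⟩ ≠ 0 := sub_ne_zero.2 (ha.ne (by simpa using hyz))
    simp only [← sub_div, inv_div]
    field_simp
    ring
  comm x y z w hxz hxw hyz hyw _ _ := by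
    simp only [natRmat]
    split_ifs
    · apply commute_Rmat <;> simpa
    · exact Commute.one_right _
    · exact Commute.one_left _
    · exact Commute.one_left _

theorem continuous_natRmat_div (a : Fin n → ℂ) (i j : ℕ) :
    Continuous fun s : ℂ => natRmat n (fun i => a i / s) i j := by
  simp only [natRmat]
  split_ifs
  · simp only [Rmat, ← sub_div, inv_div]
    fun_prop
  · exact continuous_const

theorem star_natRmat {a : Fin n → ℂ} (ha : ∀ i, star (a i) = a i) (i j : ℕ) :
    star (natRmat n a i j) = natRmat n a i j := by
  simp only [natRmat, Matrix.star_eq_conjTranspose]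
  split_ifs
  · exact conjTranspose_Rmat _ _ (by rw [star_sub, ha, ha])
  · exact Matrix.conjTranspose_one

theorem isUnit_natRmat {a : Fin n → ℂ} (ha : ∀ i j, i ≠ j → (a i - a j)⁻¹ ^ 2 ≠ 1)
    {i j : ℕ} (hij : i ≠ j) : IsUnit (natRmat n a i j) := by
  simp only [natRmat]
  split_ifs
  · exact isUnit_Rmat (ha _ _ (by simpa using hij))
  · exact isUnit_one

theorem posDef_RmatProd {a : Fin n → ℝ} (ha : ∀ i j : Fin n, i ≠ j → 1 < |a i - a j|) :
    (RmatProd n fun i => (a i : ℂ)).PosDef := by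
  obtain ⟨A, hA⟩ : ∃ A : unitInterval → Matrix (Fin n → Fin 2) (Fin n → Fin 2) ℂ, ∀ s, A s =
      pairProd (natRmat n fun i => (a i : ℂ) / ((s : ℝ) : ℂ)) (List.range n) := ⟨_, fun _ => rfl⟩
  have hinj : Function.Injective fun i => (a i : ℂ) := by
    intro i j hij
    by_contra hne
    have := ha i j hne
    rw [Complex.ofReal_injective hij, sub_self, abs_zero] at this
    exact absurd this (by norm_num)
  have hcont : Continuous A := by
    rw [funext hA]
    exact (continuous_pairProd (continuous_natRmat_div fun i => (a i : ℂ)) (List.range n)).comp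
      (Complex.continuous_ofReal.comp continuous_subtype_val)
  have hherm : ∀ s, (A s).IsHermitian := fun s => by
    rw [hA]
    refine Matrix.isHermitian_iff_isSelfAdjoint.2 <|
      isSelfAdjoint_pairProd (isYangBaxter_natRmat hinj _) ?_ List.nodup_range
    exact star_natRmat fun i => by simp
  have hunit : ∀ s, IsUnit (A s) := by
    intro s
    rw [hA]
    refine isUnit_pairProd (fun x y => isUnit_natRmat fun i j hij => ?_) List.nodup_range
    have hd := ha i j hij
    have hlt : |(s : ℝ) / (a i - a j)| < 1 := by
      rw [abs_div, abs_of_nonneg s.2.1, div_lt_one (by linarith)]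
      exact s.2.2.trans_lt hd
    rw [← sub_div, inv_div]
    exact_mod_cast ((sq_lt_one_iff_abs_lt_one _).2 hlt).ne
  have hzero : A 0 = 1 := by
    have hrow : ∀ l : List ℕ, ∀ x, rowProd (natRmat n fun _ => 0) x l = 1 := by
      intro l x
      induction l with
      | nil => rfl
      | cons y l ih => simp [rowProd, ih, natRmat, Rmat]
    have hpair : ∀ l : List ℕ, pairProd (natRmat n fun _ => 0) l = 1 := by
      intro l
      induction l with
      | nil => rfl
      | cons y l ih => simp [pairProd, ih, hrow]
    simpa [hA] using hpair _
  have hone : A 1 = RmatProd n fun i => (a i : ℂ) := by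
    simp [hA, RmatProd_eq_pairProd]
  have hA0 : (A 0).PosDef := by
    rw [hzero]
    exact Matrix.PosDef.one
  rw [← hone]
  exact posDef_of_preconnectedSpace hcont hherm hunit hA0 1

theorem Matrix.PosDef.pos_of_isRoot_charpoly {m : Type*} [Fintype m] [DecidableEq m]
    {A : Matrix m m ℂ} (hA : A.PosDef) {μ : ℂ} (hμ : A.charpoly.IsRoot μ) : 0 < μ := by
  rw [← Matrix.mem_spectrum_iff_isRoot_charpoly, hA.isHermitian.spectrum_eq_image_range] at hμ
  obtain ⟨_, ⟨i, rfl⟩, rfl⟩ := hμ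
  exact Complex.zero_lt_real.2 (hA.eigenvalues_pos i)

end RMatrix

/-- If `a₁, …, aₙ` are real numbers with `|aᵢ - aⱼ| > 1` for all `i ≠ j`, then every root
of the characteristic polynomial of `R(a₁,…,aₙ)` is a positive real number. -/
theorem RmatProd_charpoly_roots_pos (n : ℕ) (a : Fin n → ℝ)
    (ha : ∀ i j : Fin n, i ≠ j → 1 < |a i - a j|)
    (μ : ℂ) (hμ : (RmatProd n (fun i => (a i : ℂ))).charpoly.IsRoot μ) :
    μ.im = 0 ∧ 0 < μ.re := by
  have h := Complex.pos_iff.1 ((posDef_RmatProd ha).pos_of_isRoot_charpoly hμ)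
  exact ⟨h.2.symm, h.1⟩
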